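/- arXiv:1901.08219 — 8 statements merged into one kernel-verified Lean document; each statement's English description precedes it below -/
import Mathlib

section
/- Let E ⊆ X be a nonempty set of vertices. If E has nonempty intersection with every optimal cluster C_l (l = 1,...,k), then φ_0(X,E) ≤ 2·r_opt. -/
set_option autoImplicit false

open Metric
open scoped ENNReal NNReal Classical

noncomputable def costSet {X : Type*} [MetricSpace X] (X' A : Finset X) : ℝ :=
  sSup ((fun p => Metric.infDist p (A : Set X)) '' (X' : Set X))

/-- `phi ε z A` is `φ_ε(X, A)`: the smallest clustering cost (radius) achievable with
center set `A` after excluding at most `(1+ε)z` outliers from `X`. -/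
noncomputable def phi {X : Type*} [MetricSpace X] [Fintype X] (ε : ℝ) (z : ℕ) (A : Finset X) : ℝ :=
  sInf {r : ℝ | ∃ X' : Finset X, (Fintype.card X : ℝ) - (1 + ε) * z ≤ X'.card ∧ r = costSet X' A}

theorem costSet_nonneg {X : Type*} [MetricSpace X] (X' A : Finset X) : 0 ≤ costSet X' A := by
  apply Real.sSup_nonneg
  rintro _ ⟨p, -, rfl⟩
  exact Metric.infDist_nonneg

theorem costSet_le {X : Type*} [MetricSpace X] {X' A : Finset X} {r : ℝ} (hr : 0 ≤ r)
    (h : ∀ p ∈ X', ∃ q ∈ A, dist p q ≤ r) : costSet X' A ≤ r := by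
  refine Real.sSup_le ?_ hr
  rintro _ ⟨p, hp, rfl⟩
  obtain ⟨q, hq, hpq⟩ := h p (Finset.mem_coe.mp hp)
  exact (Metric.infDist_le_dist_of_mem (Finset.mem_coe.mpr hq)).trans hpq

theorem phi_le_costSet {X : Type*} [MetricSpace X] [Fintype X] {ε : ℝ} {z : ℕ} (X' A : Finset X)
    (h : (Fintype.card X : ℝ) - (1 + ε) * z ≤ X'.card) : phi ε z A ≤ costSet X' A := by
  refine csInf_le ⟨0, ?_⟩ ⟨X', h, rfl⟩
  rintro _ ⟨Y, -, rfl⟩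
  exact costSet_nonneg Y A

/-- Claim 3: if `E` intersects every optimal cluster `C l`, then
`φ_0(X, E) ≤ 2·r_opt`. -/
theorem hit_all_clusters_two_approx
    {X : Type*} [MetricSpace X] [Fintype X] [DecidableEq X]
    (n k z : ℕ) (hn : Fintype.card X = n) (hz : 0 < z) (hzn : z < n) (hk : 1 ≤ k)
    (Xopt : Finset X) (C : Fin k → Finset X) (o : Fin k → X)
    (ropt : ℝ) (hropt0 : 0 ≤ ropt)
    (hXoptcard : Xopt.card = n - z)
    (hunion : Finset.univ.biUnion C = Xopt)
    (hdisj : ∀ i j : Fin k, i ≠ j → Disjoint (C i) (C j))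
    (hcover : ∀ l : Fin k, ∀ p ∈ C l, dist p (o l) ≤ ropt)
    (hoptmin : ∀ A : Finset X, A.card = k → ropt ≤ phi 0 z A)
    (E : Finset X) (hE : E.Nonempty)
    (hhit : ∀ l : Fin k, (E ∩ C l).Nonempty) :
    phi 0 z E ≤ 2 * ropt := by
  refine (phi_le_costSet Xopt E ?_).trans (costSet_le (by linarith) fun p hp => ?_)
  · rw [hn, hXoptcard, Nat.cast_sub hzn.le]
    linarith
  · rw [← hunion] at hp
    obtain ⟨l, -, hpl⟩ := Finset.mem_biUnion.mp hp
    obtain ⟨q, hq⟩ := hhit l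
    obtain ⟨hqE, hql⟩ := Finset.mem_inter.mp hq
    refine ⟨q, hqE, ?_⟩
    linarith [dist_triangle_right p q (o l), hcover l p hpl, hcover l q hql]
end

section
/- Let E ⊆ X be nonempty, let J = { l ∈ {1,...,k} : E ∩ C_l ≠ ∅ }, let ε > 0, and let Q ⊆ X with |Q| = (1+ε)z. If d(Q,E) > 2·r_opt (i.e., every point of Q is at distance greater than 2·r_opt from every point of E), then Q ∩ C_l = ∅ for every l ∈ J; consequently Q ∩ X_opt ⊆ ∪_{l∉J} C_l and |Q ∩ X_opt| ≥ ε·z, so the fraction of points of Q lying in clusters untouched by E is at least ε/(1+ε). -/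
set_option autoImplicit false

open Metric
open scoped ENNReal NNReal Classical

/-- inside Lemma 2: if every point of `Q` (of size `(1+ε)z`) is at distance
`> 2·r_opt` from `E`, then `Q` avoids every cluster touched by `E`; hence
`Q ∩ X_opt ⊆ ∪_{l ∉ J} C_l`, `|Q ∩ X_opt| ≥ ε·z`, and the fraction of points of `Q` lying in
clusters untouched by `E` is at least `ε/(1+ε)`. -/
theorem far_set_hits_untouched_clusters
    {X : Type*} [MetricSpace X] [Fintype X] [DecidableEq X]
    (n k z : ℕ) (hn : Fintype.card X = n) (hz : 0 < z) (hzn : z < n) (hk : 1 ≤ k)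
    (Xopt : Finset X) (C : Fin k → Finset X) (o : Fin k → X)
    (ropt : ℝ) (hropt0 : 0 ≤ ropt)
    (hXoptcard : Xopt.card = n - z)
    (hunion : Finset.univ.biUnion C = Xopt)
    (hdisj : ∀ i j : Fin k, i ≠ j → Disjoint (C i) (C j))
    (hcover : ∀ l : Fin k, ∀ p ∈ C l, dist p (o l) ≤ ropt)
    (hoptmin : ∀ A : Finset X, A.card = k → ropt ≤ phi 0 z A)
    (E : Finset X) (hE : E.Nonempty)
    (ε : ℝ) (hε : 0 < ε)
    (Q : Finset X) (hQcard : (Q.card : ℝ) = (1 + ε) * z)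
    (hQfar : ∀ p ∈ Q, ∀ q ∈ E, 2 * ropt < dist p q) :
    (∀ l ∈ Finset.univ.filter (fun l : Fin k => (E ∩ C l).Nonempty), Q ∩ C l = ∅) ∧
    Q ∩ Xopt ⊆
      (Finset.univ \ Finset.univ.filter (fun l : Fin k => (E ∩ C l).Nonempty)).biUnion C ∧
    ε * z ≤ ((Q ∩ Xopt).card : ℝ) ∧
    ε / (1 + ε) ≤
      ((Q ∩ (Finset.univ \
          Finset.univ.filter (fun l : Fin k => (E ∩ C l).Nonempty)).biUnion C).card : ℝ) /
        Q.card := by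
  have havoid : ∀ l ∈ Finset.univ.filter (fun l : Fin k => (E ∩ C l).Nonempty),
      Q ∩ C l = ∅ := by
    intro l hl
    obtain ⟨q, hq⟩ := (Finset.mem_filter.mp hl).2
    obtain ⟨hqE, hqC⟩ := Finset.mem_inter.mp hq
    refine Finset.eq_empty_of_forall_notMem fun p hp => ?_
    obtain ⟨hpQ, hpC⟩ := Finset.mem_inter.mp hp
    have hfar := hQfar p hpQ q hqE
    have htri := dist_triangle_right p q (o l)
    linarith [hcover l p hpC, hcover l q hqC]
  have hsub : Q ∩ Xopt ⊆
      (Finset.univ \ Finset.univ.filter (fun l : Fin k => (E ∩ C l).Nonempty)).biUnion C := by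
    intro p hp
    obtain ⟨hpQ, hpX⟩ := Finset.mem_inter.mp hp
    rw [← hunion] at hpX
    obtain ⟨l, -, hpC⟩ := Finset.mem_biUnion.mp hpX
    refine Finset.mem_biUnion.mpr ⟨l, Finset.mem_sdiff.mpr ⟨Finset.mem_univ l, fun hl => ?_⟩, hpC⟩
    exact Finset.notMem_empty p (havoid l hl ▸ Finset.mem_inter.mpr ⟨hpQ, hpC⟩)
  have hcard : ε * z ≤ ((Q ∩ Xopt).card : ℝ) := by
    have hinter := Finset.card_union_add_card_inter Q Xopt
    have hunion_le := Finset.card_le_univ (Q ∪ Xopt)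
    have hnat : Q.card ≤ (Q ∩ Xopt).card + z := by omega
    have hreal : (Q.card : ℝ) ≤ (Q ∩ Xopt).card + z := by exact_mod_cast hnat
    linarith
  refine ⟨havoid, hsub, hcard, ?_⟩
  have hmono := Finset.card_le_card (Finset.subset_inter Finset.inter_subset_left hsub)
  have hz' : (0 : ℝ) < z := by exact_mod_cast hz
  rw [hQcard, ← mul_div_mul_right ε (1 + ε) hz'.ne']
  gcongr
  exact hcard.trans (by exact_mod_cast hmono)
end

section
/- Fix ε > 0 and η ∈ (0,1), and run Algorithm 1 with t = (k+√k)/(1−η) rounds. Then with probability at least (1−η)·(1−e^{−(1−η)/4}), the output set E satisfies φ_ε(X,E) ≤ 2·r_opt; in particular, E is a (2, O(1/ε))-approximation for (k,z)_ε-center clustering, with |E| = O((t/ε)·log(1/η)). -/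
set_option autoImplicit false

open Metric
open scoped ENNReal NNReal Classical

/-- The distribution of the set formed by `m` independent uniform draws from `s`. -/
noncomputable def sampleMany {X : Type*} [DecidableEq X] (s : Finset X) (hs : s.Nonempty) :
    ℕ → PMF (Finset X)
  | 0 => PMF.pure ∅
  | m + 1 => (PMF.uniformOfFinset s hs).bind fun v => (sampleMany s hs m).map (insert v)

/-- Algorithm 1: initialize `E` with `m₀` uniform random vertices of `X`; in each of the
subsequent rounds, let `F E` be a set of the `(1+ε)z` vertices farthest from `E`
(`F` is a fixed tie-breaking selector) and add `m₁` uniform random vertices of `F E` to `E`.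
`algorithm1 F hF m₀ m₁ j` is the distribution of `E` after the initialization plus `j`
further rounds. -/
noncomputable def algorithm1 {X : Type*} [MetricSpace X] [Fintype X] [DecidableEq X] [Nonempty X]
    (F : Finset X → Finset X) (hF : ∀ E, (F E).Nonempty) (m₀ m₁ : ℕ) : ℕ → PMF (Finset X)
  | 0 => sampleMany Finset.univ Finset.univ_nonempty m₀
  | j + 1 => (algorithm1 F hF m₀ m₁ j).bind fun E =>
      (sampleMany (F E) (hF E) m₁).map (fun s => E ∪ s)

/-- Expectation of a nonnegative function under a discrete distribution. -/
noncomputable def PMF.expect {α : Type*} (p : PMF α) (f : α → ℝ≥0∞) : ℝ≥0∞ := ∑' a, p a * f a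

namespace PMF

variable {α β : Type*}

lemma expect_mono (p : PMF α) {f g : α → ℝ≥0∞} (h : ∀ a, f a ≤ g a) :
    p.expect f ≤ p.expect g :=
  ENNReal.tsum_le_tsum fun a => mul_le_mul_right (h a) _

lemma expect_add (p : PMF α) (f g : α → ℝ≥0∞) :
    p.expect (fun a => f a + g a) = p.expect f + p.expect g := by
  simp only [expect, mul_add, ENNReal.tsum_add]

lemma expect_const_mul (p : PMF α) (c : ℝ≥0∞) (f : α → ℝ≥0∞) :
    p.expect (fun a => c * f a) = c * p.expect f := by
  simp only [expect, mul_left_comm _ c, ENNReal.tsum_mul_left]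

lemma expect_const (p : PMF α) (c : ℝ≥0∞) : p.expect (fun _ => c) = c := by
  simp only [expect, ENNReal.tsum_mul_right, p.tsum_coe, one_mul]

lemma expect_pure (a : α) (f : α → ℝ≥0∞) : (PMF.pure a).expect f = f a := by
  rw [expect, tsum_eq_single a]
  · simp
  · intro b hb
    simp [PMF.pure_apply, hb]

lemma expect_bind (p : PMF α) (g : α → PMF β) (f : β → ℝ≥0∞) :
    (p.bind g).expect f = p.expect fun a => (g a).expect f := by
  simp only [expect, PMF.bind_apply, ← ENNReal.tsum_mul_right, ← ENNReal.tsum_mul_left]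
  rw [ENNReal.tsum_comm]
  simp only [mul_assoc]

lemma expect_map (p : PMF α) (g : α → β) (f : β → ℝ≥0∞) :
    (p.map g).expect f = p.expect fun a => f (g a) := by
  simp only [PMF.map, expect_bind, Function.comp_apply, expect_pure]

lemma expect_uniformOfFinset_notMem [DecidableEq α] (s T : Finset α) (hs : s.Nonempty) :
    (PMF.uniformOfFinset s hs).expect (fun v => if v ∈ T then 0 else 1)
      = ((s \ T).card : ℝ≥0∞) / s.card := by
  have h : ∀ v, PMF.uniformOfFinset s hs v * (if v ∈ T then 0 else 1)
      = if v ∈ s \ T then (s.card : ℝ≥0∞)⁻¹ else 0 := by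
    intro v
    by_cases h1 : v ∈ s <;> by_cases h2 : v ∈ T <;> simp [PMF.uniformOfFinset_apply, h1, h2]
  simp only [expect, h]
  rw [tsum_eq_sum (s := s \ T) (fun b hb => if_neg hb),
    Finset.sum_congr rfl (fun b hb => if_pos hb), Finset.sum_const, nsmul_eq_mul, div_eq_mul_inv]

lemma const_mul_toOuterMeasure_le_expect (p : PMF α) (S : Set α) (c : ℝ≥0∞) {f : α → ℝ≥0∞}
    (h : ∀ a ∈ S, c ≤ f a) : c * p.toOuterMeasure S ≤ p.expect f := by
  rw [PMF.toOuterMeasure_apply, ← ENNReal.tsum_mul_left]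
  refine ENNReal.tsum_le_tsum fun a => ?_
  by_cases ha : a ∈ S
  · rw [Set.indicator_of_mem ha, mul_comm]
    exact mul_le_mul_right (h a ha) _
  · simp [ha]

lemma one_le_toOuterMeasure_add_compl (p : PMF α) (S : Set α) :
    1 ≤ p.toOuterMeasure S + p.toOuterMeasure Sᶜ := by
  calc (1 : ℝ≥0∞) = p.toOuterMeasure (S ∪ Sᶜ) := by
        rw [Set.union_compl_self, PMF.toOuterMeasure_apply]
        simp [p.tsum_coe]
    _ ≤ _ := MeasureTheory.measure_union_le _ _

end PMF

section Sampling

variable {X : Type*} [DecidableEq X]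

lemma expect_sampleMany_disjoint_le (s T : Finset X) (hs : s.Nonempty) {q : ℝ≥0∞}
    (hq : ((s \ T).card : ℝ≥0∞) / s.card ≤ q) (m : ℕ) :
    (sampleMany s hs m).expect (fun A => if Disjoint A T then 1 else 0) ≤ q ^ m := by
  induction m with
  | zero => simp [sampleMany, PMF.expect_pure]
  | succ m ih =>
    have h : ∀ (v : X) (A : Finset X), (if Disjoint (insert v A) T then (1 : ℝ≥0∞) else 0)
        = (if v ∈ T then 0 else 1) * (if Disjoint A T then 1 else 0) := by
      intro v A
      by_cases h1 : v ∈ T <;> by_cases h2 : Disjoint A T <;>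
        simp [Finset.disjoint_insert_left, h1, h2]
    simp only [sampleMany, PMF.expect_bind, PMF.expect_map, h, PMF.expect_const_mul]
    simp only [mul_comm _ ((sampleMany s hs m).expect _), PMF.expect_const_mul,
      PMF.expect_uniformOfFinset_notMem, pow_succ]
    exact mul_le_mul' ih hq

lemma expect_sampleMany_le (s T : Finset X) (hs : s.Nonempty) {q : ℝ}
    (hq : ((s \ T).card : ℝ) / s.card ≤ q) {m : ℕ} {η x : ℝ} (hm : q ^ m ≤ η)
    (hη : 0 ≤ η) (hx0 : 0 ≤ x) (hx1 : x ≤ 1) :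
    (sampleMany s hs m).expect (fun A => if Disjoint A T then 1 else ENNReal.ofReal x)
      ≤ ENNReal.ofReal (x + (1 - x) * η) := by
  have hs' : (0 : ℝ) < s.card := by exact_mod_cast hs.card_pos
  have hq0 : 0 ≤ q := le_trans (by positivity) hq
  have hq' : ((s \ T).card : ℝ≥0∞) / s.card ≤ ENNReal.ofReal q := by
    rw [← ENNReal.ofReal_natCast, ← ENNReal.ofReal_natCast, ← ENNReal.ofReal_div_of_pos hs']
    exact ENNReal.ofReal_le_ofReal hq
  have h : ∀ A : Finset X, (if Disjoint A T then 1 else ENNReal.ofReal x)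
      = ENNReal.ofReal x + ENNReal.ofReal (1 - x) * (if Disjoint A T then 1 else 0) := by
    intro A
    split_ifs
    · rw [mul_one, ← ENNReal.ofReal_add hx0 (by linarith)]
      simp
    · simp
  simp only [h, PMF.expect_add, PMF.expect_const, PMF.expect_const_mul]
  rw [ENNReal.ofReal_add hx0 (mul_nonneg (by linarith) hη), ENNReal.ofReal_mul (by linarith)]
  gcongr
  refine (expect_sampleMany_disjoint_le s T hs hq' m).trans ?_
  rw [← ENNReal.ofReal_pow hq0]
  exact ENNReal.ofReal_le_ofReal hm

lemma card_le_of_mem_support_sampleMany (s : Finset X) (hs : s.Nonempty) (m : ℕ) :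
    ∀ A ∈ (sampleMany s hs m).support, A.card ≤ m := by
  induction m with
  | zero => simp [sampleMany]
  | succ m ih =>
    intro A hA
    simp only [sampleMany, PMF.mem_support_bind_iff, PMF.mem_support_map_iff] at hA
    obtain ⟨v, -, B, hB, rfl⟩ := hA
    exact (Finset.card_insert_le _ _).trans (Nat.succ_le_succ (ih B hB))

end Sampling

lemma pow_ceil_log_le {q η : ℝ} (hq0 : 0 ≤ q) (hq1 : q < 1) (hη : 0 < η) :
    q ^ ⌈1 / (1 - q) * Real.log (1 / η)⌉₊ ≤ η := by
  set m := ⌈1 / (1 - q) * Real.log (1 / η)⌉₊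
  have hm : 1 / (1 - q) * Real.log (1 / η) ≤ m := Nat.le_ceil _
  have hlog : Real.log (1 / η) ≤ m * (1 - q) := by
    rwa [one_div_mul_eq_div, div_le_iff₀ (by linarith)] at hm
  calc q ^ m ≤ Real.exp (q - 1) ^ m := by
        gcongr
        linarith [Real.add_one_le_exp (q - 1)]
    _ = Real.exp (m * (q - 1)) := (Real.exp_nat_mul _ _).symm
    _ ≤ Real.exp (Real.log η) := by
        gcongr
        rw [one_div, Real.log_inv] at hlog
        linarith
    _ = η := Real.exp_log hη

lemma one_add_le_exp_sub_sq {s : ℝ} (hs0 : 0 ≤ s) (hs1 : s ≤ 1) :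
    1 + s ≤ Real.exp (s - s ^ 2 / 4) := by
  have h := Real.quadratic_le_exp_of_nonneg (x := s - s ^ 2 / 4) (by nlinarith)
  refine le_trans ?_ h
  nlinarith [mul_nonneg (sq_nonneg s) (sub_nonneg.2 hs1),
    mul_nonneg (sq_nonneg s) (sq_nonneg s)]

/-- Chernoff-type bound for the exponential potential with base `√k / (√k + 1)`. -/
lemma pow_le_exp_mul_pow {k t : ℕ} (hk : 1 ≤ k) {p : ℝ} (hp0 : 0 < p) (hp1 : p ≤ 1)
    (ht : ((k : ℝ) + √k) / p ≤ t) :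
    (√k / (√k + 1) + (1 - √k / (√k + 1)) * (1 - p)) ^ t
      ≤ Real.exp (-1 / 4) * (√k / (√k + 1)) ^ k := by
  have hk1 : (1 : ℝ) ≤ √k := Real.one_le_sqrt.2 (by exact_mod_cast hk)
  have hsq : √(k : ℝ) * √k = k := Real.mul_self_sqrt (by positivity)
  set r := √(k : ℝ)
  have hr : 0 < r := by linarith
  set x := r / (r + 1) with hx
  have hx1 : 1 - x = 1 / (r + 1) := by rw [hx]; field_simp; ring
  have hx0 : 0 < x := by positivity
  have h1x : 0 < 1 - x := by rw [hx1]; positivity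
  have hxinv : x * (1 + 1 / r) = 1 := by rw [hx]; field_simp
  have htp : (k : ℝ) + r ≤ t * p := by rwa [div_le_iff₀ hp0] at ht
  have hmean : ((k : ℝ) + r) * (1 - x) = r := by rw [hx1, ← hsq]; field_simp
  have hinv : (1 + 1 / r) ^ k ≤ Real.exp (r - 1 / 4) := by
    calc (1 + 1 / r) ^ k ≤ Real.exp (1 / r - (1 / r) ^ 2 / 4) ^ k := by
          gcongr
          exact one_add_le_exp_sub_sq (by positivity) (by rw [div_le_one hr]; exact hk1)
      _ = Real.exp (k * (1 / r - (1 / r) ^ 2 / 4)) := (Real.exp_nat_mul _ _).symm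
      _ = Real.exp (r - 1 / 4) := by
          congr 1
          rw [← hsq]
          field_simp
  calc (x + (1 - x) * (1 - p)) ^ t ≤ Real.exp (-(p * (1 - x))) ^ t := by
        refine pow_le_pow_left₀ (add_nonneg hx0.le (mul_nonneg h1x.le (by linarith))) ?_ t
        linarith [Real.add_one_le_exp (-(p * (1 - x)))]
    _ = Real.exp (t * -(p * (1 - x))) := (Real.exp_nat_mul _ _).symm
    _ ≤ Real.exp (-r) := by
        gcongr
        nlinarith
    _ = Real.exp (-1 / 4) * (x * (1 + 1 / r)) ^ k * Real.exp (-(r - 1 / 4)) := by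
        rw [hxinv, one_pow, mul_one, ← Real.exp_add]
        ring_nf
    _ = Real.exp (-1 / 4) * x ^ k * ((1 + 1 / r) ^ k * Real.exp (-(r - 1 / 4))) := by
        rw [mul_pow]; ring
    _ ≤ Real.exp (-1 / 4) * x ^ k * (Real.exp (r - 1 / 4) * Real.exp (-(r - 1 / 4))) := by
        gcongr
    _ = Real.exp (-1 / 4) * x ^ k := by
        rw [← Real.exp_add, add_neg_cancel, Real.exp_zero, mul_one]

section HitCount

variable {X : Type*}

/-- The number of clusters containing a point of `E`. -/
noncomputable def hitCount {k : ℕ} (C : Fin k → Finset X) (E : Finset X) : ℕ :=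
  (Finset.univ.filter fun l => ∃ p ∈ C l, p ∈ E).card

lemma hitCount_le {k : ℕ} (C : Fin k → Finset X) (E : Finset X) : hitCount C E ≤ k :=
  (Finset.card_le_univ _).trans_eq (Fintype.card_fin k)

lemma hitCount_mono {k : ℕ} (C : Fin k → Finset X) {E E' : Finset X} (h : E ⊆ E') :
    hitCount C E ≤ hitCount C E' := by
  refine Finset.card_le_card fun l => ?_
  simp only [Finset.mem_filter, Finset.mem_univ, true_and]
  exact fun ⟨p, hp, hpE⟩ => ⟨p, hp, h hpE⟩

lemma hitCount_lt {k : ℕ} {C : Fin k → Finset X} {E E' : Finset X} (h : E ⊆ E') {l : Fin k}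
    {p : X} (hp : p ∈ C l) (hpE : p ∈ E') (hl : ∀ e ∈ E, e ∉ C l) :
    hitCount C E < hitCount C E' := by
  refine Finset.card_lt_card (Finset.ssubset_iff_of_subset (fun l => ?_) |>.2 ⟨l, ?_, ?_⟩)
  · simp only [Finset.mem_filter, Finset.mem_univ, true_and]
    exact fun ⟨p, hp, hpE⟩ => ⟨p, hp, h hpE⟩
  · simp only [Finset.mem_filter, Finset.mem_univ, true_and]
    exact ⟨p, hp, hpE⟩
  · simp only [Finset.mem_filter, Finset.mem_univ, true_and]
    exact fun ⟨q, hq, hqE⟩ => hl q hqE hq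

end HitCount

section Clustering

variable {X : Type*} [MetricSpace X]

/-- All but `b` points of `X` lie within distance `R` of `E`. -/
def CoversWithin [Fintype X] (b R : ℝ) (E : Finset X) : Prop :=
  ∃ X' : Finset X, (Fintype.card X : ℝ) - b ≤ X'.card ∧ ∀ p ∈ X', ∃ e ∈ E, dist p e ≤ R

lemma CoversWithin.mono [Fintype X] {b R : ℝ} {E E' : Finset X} (h : CoversWithin b R E)
    (hE : E ⊆ E') : CoversWithin b R E' := by
  obtain ⟨X', hc, hX'⟩ := h
  refine ⟨X', hc, fun p hp => ?_⟩
  obtain ⟨e, he, hd⟩ := hX' p hp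
  exact ⟨e, hE he, hd⟩

lemma CoversWithin.phi_le [Fintype X] {ε R : ℝ} {z : ℕ} {E : Finset X} (hR : 0 ≤ R)
    (h : CoversWithin ((1 + ε) * z) R E) : phi ε z E ≤ R := by
  obtain ⟨X', hc, hX'⟩ := h
  have hle : phi ε z E ≤ costSet X' E := by
    refine csInf_le ⟨0, ?_⟩ ⟨X', hc, rfl⟩
    rintro _ ⟨Y, -, rfl⟩
    exact Real.sSup_nonneg (by rintro _ ⟨p, -, rfl⟩; exact infDist_nonneg)
  refine hle.trans (Real.sSup_le ?_ hR)
  rintro _ ⟨p, hp, rfl⟩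
  obtain ⟨e, he, hd⟩ := hX' p hp
  exact (infDist_le_dist_of_mem (Finset.mem_coe.2 he)).trans hd

lemma lt_dist_of_not_coversWithin [Fintype X] [DecidableEq X] {b R : ℝ} {E Q : Finset X}
    (hcard : (Q.card : ℝ) = b)
    (hfar : ∀ p ∉ Q, ∀ q ∈ Q, infDist p (E : Set X) ≤ infDist q (E : Set X))
    (h : ¬ CoversWithin b R E) {q e : X} (hq : q ∈ Q) (he : e ∈ E) : R < dist q e := by
  by_contra! hd
  refine h ⟨Qᶜ, ?_, fun p hp => ?_⟩
  · rw [Finset.card_compl, Nat.cast_sub (Finset.card_le_univ Q), hcard]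
  · obtain ⟨e', he', hpe⟩ := E.finite_toSet.isCompact.exists_infDist_eq_dist ⟨e, he⟩ p
    refine ⟨e', he', hpe ▸ ?_⟩
    exact (hfar p (Finset.mem_compl.1 hp) q hq).trans ((infDist_le_dist_of_mem he).trans hd)

/-- Potential function: zero once `E` covers, else exponentially small in the number of
clusters already hit. -/
noncomputable def potential [Fintype X] {k : ℕ} (C : Fin k → Finset X) (b R x : ℝ)
    (E : Finset X) : ℝ≥0∞ :=
  if CoversWithin b R E then 0 else ENNReal.ofReal x ^ hitCount C E

lemma potential_le [Fintype X] {k : ℕ} (C : Fin k → Finset X) (b R x : ℝ) (E : Finset X) :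
    potential C b R x E ≤ ENNReal.ofReal x ^ hitCount C E := by
  unfold potential
  split_ifs
  · exact zero_le
  · exact le_rfl

variable [Fintype X] [DecidableEq X]

lemma potential_union_le {k : ℕ} {C : Fin k → Finset X} {b R x : ℝ} (hx1 : x ≤ 1)
    {E T A : Finset X}
    (hT : ¬ CoversWithin b R E → ∀ p ∈ T, ∃ l, p ∈ C l ∧ ∀ e ∈ E, e ∉ C l) :
    potential C b R x (E ∪ A)
      ≤ potential C b R x E * (if Disjoint A T then 1 else ENNReal.ofReal x) := by
  have hx : ENNReal.ofReal x ≤ 1 := ENNReal.ofReal_le_one.2 hx1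
  by_cases hE : CoversWithin b R E
  · simp [potential, hE.mono (Finset.subset_union_left (s₂ := A))]
  · refine (potential_le C b R x (E ∪ A)).trans ?_
    rw [potential, if_neg hE]
    split_ifs with hA
    · rw [mul_one]
      exact pow_le_pow_of_le_one zero_le hx (hitCount_mono C Finset.subset_union_left)
    · obtain ⟨p, hpA, hpT⟩ := Finset.not_disjoint_iff.1 hA
      obtain ⟨l, hpl, hl⟩ := hT hE p hpT
      rw [← pow_succ]
      exact pow_le_pow_of_le_one zero_le hx
        (hitCount_lt Finset.subset_union_left hpl (Finset.mem_union_right E hpA) hl)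

lemma card_le_of_mem_support_algorithm1 [Nonempty X] (F : Finset X → Finset X)
    (hF : ∀ E, (F E).Nonempty) (m₀ m₁ j : ℕ) :
    ∀ E ∈ (algorithm1 F hF m₀ m₁ j).support, E.card ≤ m₀ + j * m₁ := by
  induction j with
  | zero => simpa [algorithm1] using card_le_of_mem_support_sampleMany _ _ m₀
  | succ j ih =>
    intro E hE
    simp only [algorithm1, PMF.mem_support_bind_iff, PMF.mem_support_map_iff] at hE
    obtain ⟨E', hE', A, hA, rfl⟩ := hE
    have h1 := ih E' hE'
    have h2 := card_le_of_mem_support_sampleMany _ _ _ A hA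
    have h3 := Finset.card_union_le E' A
    rw [Nat.succ_mul]
    omega

lemma expect_algorithm1_le [Nonempty X] {F : Finset X → Finset X} {hF : ∀ E, (F E).Nonempty}
    {m₀ m₁ : ℕ} {W : Finset X → ℝ≥0∞} {ρ : ℝ≥0∞}
    (h0 : (sampleMany Finset.univ Finset.univ_nonempty m₀).expect W ≤ ρ)
    (hstep : ∀ E, (sampleMany (F E) (hF E) m₁).expect (fun A => W (E ∪ A)) ≤ ρ * W E) (j : ℕ) :
    (algorithm1 F hF m₀ m₁ j).expect W ≤ ρ ^ (j + 1) := by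
  induction j with
  | zero => simpa [algorithm1] using h0
  | succ j ih =>
    simp only [algorithm1, PMF.expect_bind, PMF.expect_map]
    refine (PMF.expect_mono _ hstep).trans ?_
    rw [PMF.expect_const_mul, pow_succ' ρ (j + 1)]
    exact mul_le_mul_right ih ρ

end Clustering

/-- Theorem 1: running Algorithm 1 for `t = (k+√k)/(1-η)` rounds, with
probability at least `(1-η)(1-e^{-(1-η)/4})` the output `E` satisfies `φ_ε(X,E) ≤ 2·r_opt`;
moreover every possible output has at most `m₀ + (t-1)·m₁ = O((t/ε)·log(1/η))` vertices. -/
theorem algorithm1_bicriteria_two_approx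
    {X : Type*} [MetricSpace X] [Fintype X] [DecidableEq X] [Nonempty X]
    (n k z : ℕ) (hn : Fintype.card X = n) (hz : 0 < z) (hzn : z < n) (hk : 1 ≤ k)
    (Xopt : Finset X) (C : Fin k → Finset X) (o : Fin k → X)
    (ropt : ℝ) (hropt0 : 0 ≤ ropt)
    (hXoptcard : Xopt.card = n - z)
    (hunion : Finset.univ.biUnion C = Xopt)
    (hdisj : ∀ i j : Fin k, i ≠ j → Disjoint (C i) (C j))
    (hcover : ∀ l : Fin k, ∀ p ∈ C l, dist p (o l) ≤ ropt)
    (hoptmin : ∀ A : Finset X, A.card = k → ropt ≤ phi 0 z A)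
    (ε η : ℝ) (hε : 0 < ε) (hη : η ∈ Set.Ioo (0 : ℝ) 1)
    (F : Finset X → Finset X) (hF : ∀ E, (F E).Nonempty)
    (hFcard : ∀ E, ((F E).card : ℝ) = (1 + ε) * z)
    (hFfar : ∀ E : Finset X, ∀ p ∉ F E, ∀ q ∈ F E,
      infDist p (E : Set X) ≤ infDist q (E : Set X))
    (m₀ m₁ t : ℕ)
    (hm₀ : m₀ = ⌈(1 / (1 - (z : ℝ) / n)) * Real.log (1 / η)⌉₊)
    (hm₁ : m₁ = ⌈((1 + ε) / ε) * Real.log (1 / η)⌉₊)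
    (ht : t = ⌈((k : ℝ) + Real.sqrt k) / (1 - η)⌉₊) :
    ENNReal.ofReal ((1 - η) * (1 - Real.exp (-(1 - η) / 4))) ≤
      (algorithm1 F hF m₀ m₁ (t - 1)).toOuterMeasure
        {E : Finset X | phi ε z E ≤ 2 * ropt} ∧
    ∀ E ∈ (algorithm1 F hF m₀ m₁ (t - 1)).support, E.card ≤ m₀ + (t - 1) * m₁ := by
  obtain ⟨hη0, hη1⟩ := hη
  refine ⟨?_, card_le_of_mem_support_algorithm1 F hF m₀ m₁ (t - 1)⟩
  subst hn
  have hzpos : (0 : ℝ) < z := by exact_mod_cast hz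
  have hznR : (z : ℝ) < Fintype.card X := by exact_mod_cast hzn
  have hnpos : (0 : ℝ) < Fintype.card X := hzpos.trans hznR
  have hk1 : (1 : ℝ) ≤ √k := Real.one_le_sqrt.2 (by exact_mod_cast hk)
  have htpos : 0 < ((k : ℝ) + √k) / (1 - η) := div_pos (by positivity) (by linarith)
  have ht1 : t - 1 + 1 = t := Nat.sub_add_cancel (ht ▸ Nat.ceil_pos.2 htpos)
  set x := √(k : ℝ) / (√k + 1) with hx
  have hx0 : 0 < x := by positivity
  have hx1 : x ≤ 1 := by rw [hx, div_le_one (by positivity)]; linarith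
  have hmem : ∀ p ∈ Xopt, ∃ l, p ∈ C l := by
    intro p hp
    simpa [← hunion] using hp
  have hout : Xoptᶜ.card = z := by rw [Finset.card_compl, hXoptcard]; omega
  set W := potential C ((1 + ε) * z) (2 * ropt) x with hW
  set ρ := x + (1 - x) * η with hρ
  have hρ0 : 0 ≤ ρ := add_nonneg hx0.le (mul_nonneg (by linarith) hη0.le)
  have h0 : (sampleMany Finset.univ Finset.univ_nonempty m₀).expect W ≤ ENNReal.ofReal ρ := by
    refine (PMF.expect_mono _ fun A => ?_).trans
      (expect_sampleMany_le Finset.univ Xopt _ (q := (z : ℝ) / Fintype.card X) (m := m₀) ?_ ?_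
        hη0.le hx0.le hx1)
    · have h := potential_union_le (C := C) (b := (1 + ε) * z) (R := 2 * ropt) hx1
        (E := ∅) (T := Xopt) (A := A)
        (fun _ p hp => (hmem p hp).imp fun l hl => ⟨hl, by simp⟩)
      rw [Finset.empty_union] at h
      refine h.trans (mul_le_of_le_one_left' ((potential_le _ _ _ _ _).trans ?_))
      exact pow_le_one' (ENNReal.ofReal_le_one.2 hx1) _
    · rw [← Finset.compl_eq_univ_sdiff, hout, Finset.card_univ]
    · rw [hm₀]
      exact pow_ceil_log_le (by positivity) ((div_lt_one hnpos).2 hznR) hη0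
  have hstep : ∀ E, (sampleMany (F E) (hF E) m₁).expect (fun A => W (E ∪ A))
      ≤ ENNReal.ofReal ρ * W E := by
    intro E
    have hT : ¬ CoversWithin ((1 + ε) * z) (2 * ropt) E →
        ∀ p ∈ F E ∩ Xopt, ∃ l, p ∈ C l ∧ ∀ e ∈ E, e ∉ C l := by
      intro hE p hp
      obtain ⟨hpF, hpX⟩ := Finset.mem_inter.1 hp
      obtain ⟨l, hl⟩ := hmem p hpX
      refine ⟨l, hl, fun e he hel => ?_⟩
      have h1 := lt_dist_of_not_coversWithin (hFcard E) (hFfar E) hE hpF he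
      linarith [dist_triangle_right p e (o l), hcover l p hl, hcover l e hel]
    refine (PMF.expect_mono _ fun A => potential_union_le hx1 hT).trans ?_
    rw [PMF.expect_const_mul, mul_comm]
    refine mul_le_mul_left (expect_sampleMany_le (F E) (F E ∩ Xopt) (hF E) (q := 1 / (1 + ε))
      ?_ ?_ hη0.le hx0.le hx1) _
    · rw [Finset.sdiff_inter_self_left, hFcard E, div_le_div_iff₀ (by positivity) (by positivity)]
      have h1 : (F E \ Xopt).card ≤ z := by
        rw [← hout]
        exact Finset.card_le_card fun p hp => by simp_all
      have h2 : ((F E \ Xopt).card : ℝ) ≤ z := by exact_mod_cast h1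
      nlinarith
    · have h := pow_ceil_log_le (q := 1 / (1 + ε)) (by positivity)
        ((div_lt_one (by positivity)).2 (by linarith)) hη0
      have hq : 1 / (1 - 1 / (1 + ε)) = (1 + ε) / ε := by
        rw [one_sub_div (by positivity), add_sub_cancel_left, one_div_div]
      rwa [hq, ← hm₁] at h
  have hexp := expect_algorithm1_le h0 hstep (t - 1)
  rw [ht1, ← ENNReal.ofReal_pow hρ0] at hexp
  have hchern : ρ ^ t ≤ Real.exp (-1 / 4) * x ^ k := by
    have h := pow_le_exp_mul_pow hk (p := 1 - η) (t := t) (by linarith) (by linarith)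
      (ht ▸ Nat.le_ceil _)
    rwa [sub_sub_cancel] at h
  set P := algorithm1 F hF m₀ m₁ (t - 1)
  set S := {E : Finset X | phi ε z E ≤ 2 * ropt}
  have hfail : P.toOuterMeasure Sᶜ ≤ ENNReal.ofReal (Real.exp (-1 / 4)) := by
    have h := PMF.const_mul_toOuterMeasure_le_expect P Sᶜ (ENNReal.ofReal x ^ k) (f := W) ?_
    · have h' := h.trans (hexp.trans (ENNReal.ofReal_le_ofReal hchern))
      rw [ENNReal.ofReal_mul (Real.exp_nonneg _), ENNReal.ofReal_pow hx0.le, mul_comm] at h'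
      refine (ENNReal.mul_le_mul_iff_left ?_ ?_).1 h'
      · exact pow_ne_zero _ (ENNReal.ofReal_pos.2 hx0).ne'
      · exact ENNReal.pow_ne_top ENNReal.ofReal_ne_top
    · intro E hE
      have hE' : ¬ CoversWithin ((1 + ε) * z) (2 * ropt) E :=
        fun hc => hE (hc.phi_le (by positivity))
      rw [hW, potential, if_neg hE']
      exact pow_le_pow_of_le_one zero_le (ENNReal.ofReal_le_one.2 hx1) (hitCount_le C E)
  have hsucc : 1 - ENNReal.ofReal (Real.exp (-1 / 4)) ≤ P.toOuterMeasure S :=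
    tsub_le_iff_right.2 ((P.one_le_toOuterMeasure_add_compl S).trans (by gcongr))
  refine le_trans ?_ hsucc
  rw [← ENNReal.ofReal_one, ← ENNReal.ofReal_sub _ (Real.exp_nonneg _)]
  refine ENNReal.ofReal_le_ofReal ?_
  have h1 : Real.exp (-1 / 4) ≤ Real.exp (-(1 - η) / 4) := by
    gcongr
    linarith
  have h2 : Real.exp (-(1 - η) / 4) ≤ 1 := Real.exp_le_one_iff.2 (by linarith)
  nlinarith
end

section
/- Let E ⊆ X be nonempty. If for every l ∈ {1,...,k} there exists a vertex q_l ∈ C_l with d(q_l, E) ≤ 2·r_opt, then every q ∈ X_opt satisfies d(q,E) ≤ 4·r_opt, and hence φ_0(X,E) ≤ 4·r_opt. -/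
set_option autoImplicit false

open Metric
open scoped ENNReal NNReal Classical

/-- inside the proof of Theorem 2: if every optimal cluster contains a vertex
within distance `2·r_opt` of `E`, then every inlier is within distance `4·r_opt` of `E`, and
`φ_0(X, E) ≤ 4·r_opt`. -/
theorem near_witness_in_each_cluster_four_approx
    {X : Type*} [MetricSpace X] [Fintype X] [DecidableEq X]
    (n k z : ℕ) (hn : Fintype.card X = n) (hz : 0 < z) (hzn : z < n) (hk : 1 ≤ k)
    (Xopt : Finset X) (C : Fin k → Finset X) (o : Fin k → X)
    (ropt : ℝ) (hropt0 : 0 ≤ ropt)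
    (hXoptcard : Xopt.card = n - z)
    (hunion : Finset.univ.biUnion C = Xopt)
    (hdisj : ∀ i j : Fin k, i ≠ j → Disjoint (C i) (C j))
    (hcover : ∀ l : Fin k, ∀ p ∈ C l, dist p (o l) ≤ ropt)
    (hoptmin : ∀ A : Finset X, A.card = k → ropt ≤ phi 0 z A)
    (E : Finset X) (hE : E.Nonempty)
    (hwitness : ∀ l : Fin k, ∃ q ∈ C l, infDist q (E : Set X) ≤ 2 * ropt) :
    (∀ p ∈ Xopt, infDist p (E : Set X) ≤ 4 * ropt) ∧ phi 0 z E ≤ 4 * ropt := by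
  have key : ∀ p ∈ Xopt, infDist p (E : Set X) ≤ 4 * ropt := by
    intro p hp
    rw [← hunion, Finset.mem_biUnion] at hp
    obtain ⟨l, -, hpl⟩ := hp
    obtain ⟨q, hq, hqE⟩ := hwitness l
    have h₁ := infDist_le_infDist_add_dist (s := (E : Set X)) (x := p) (y := q)
    have h₂ := dist_triangle_right p q (o l)
    linarith [hcover l p hpl, hcover l q hq]
  have hle : phi 0 z E ≤ costSet Xopt E := by
    refine csInf_le ⟨0, ?_⟩ ⟨Xopt, ?_, rfl⟩
    · rintro r ⟨X', -, rfl⟩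
      apply Real.sSup_nonneg
      rintro _ ⟨p, -, rfl⟩
      exact infDist_nonneg
    · rw [hn, hXoptcard, Nat.cast_sub hzn.le]
      simp
  refine ⟨key, hle.trans (Real.sSup_le ?_ (by positivity))⟩
  rintro _ ⟨p, hp, rfl⟩
  exact key p hp
end

section
/- Let γ = z/n and ε > 0. Suppose every optimal cluster C_l has |C_l| ≥ ε·z and the optimal cluster centers satisfy d(o_l, o_{l'}) > 4·r_opt for all 1 ≤ l ≠ l' ≤ k. Then with probability at least (1−γ)·(ε/(1+ε))^{k−1}, Algorithm 2 returns a set E of k vertices with φ_0(X,E) ≤ 2·r_opt, i.e., a 2-approximation for (k,z)_0-center clustering (excluding exactly z outliers). -/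
set_option autoImplicit false

open Metric
open scoped ENNReal NNReal Classical

/-- Algorithm 2: pick one uniform random vertex of `X`; in each subsequent round, let `F E`
be a set of the `(1+ε)z` vertices farthest from `E` and add one uniform random vertex of
`F E` to `E`.  `algorithm2 F hF j` is the distribution of `E` after `j + 1` picks. -/
noncomputable def algorithm2 {X : Type*} [MetricSpace X] [Fintype X] [DecidableEq X] [Nonempty X]
    (F : Finset X → Finset X) (hF : ∀ E, (F E).Nonempty) : ℕ → PMF (Finset X)
  | 0 => (PMF.uniformOfFinset Finset.univ Finset.univ_nonempty).map (fun v => {v})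
  | j + 1 => (algorithm2 F hF j).bind fun E =>
      (PMF.uniformOfFinset (F E) (hF E)).map (fun v => insert v E)

theorem PMF.mul_toOuterMeasure_le_toOuterMeasure_bind {α β : Type*} (p : PMF α) (f : α → PMF β)
    (t : Set α) (s : Set β) (c : ℝ≥0∞) (h : ∀ a ∈ t, c ≤ (f a).toOuterMeasure s) :
    p.toOuterMeasure t * c ≤ (p.bind f).toOuterMeasure s := by
  rw [PMF.toOuterMeasure_bind_apply, PMF.toOuterMeasure_apply, ← ENNReal.tsum_mul_right]
  refine ENNReal.tsum_le_tsum fun a => ?_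
  by_cases ha : a ∈ t
  · simpa [ha] using mul_le_mul_right (h a ha) (p a)
  · simp [ha]

theorem PMF.ofReal_le_toOuterMeasure_uniformOfFinset {α : Type*} (s : Finset α) (hs : s.Nonempty)
    (t : Set α) (u : Finset α) (hus : u ⊆ s) (hut : ∀ x ∈ u, x ∈ t) (c : ℝ)
    (hc : c * s.card ≤ u.card) :
    ENNReal.ofReal c ≤ (PMF.uniformOfFinset s hs).toOuterMeasure t := by
  rw [PMF.toOuterMeasure_uniformOfFinset_apply]
  have hle : u.card ≤ (s.filter (· ∈ t)).card :=
    Finset.card_le_card fun x hx => Finset.mem_filter.2 ⟨hus hx, hut x hx⟩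
  have hpos : (0 : ℝ) < s.card := by exact_mod_cast hs.card_pos
  rw [ENNReal.le_div_iff_mul_le (Or.inl (by exact_mod_cast hs.card_pos.ne'))
    (Or.inl (ENNReal.natCast_ne_top _)), ← ENNReal.ofReal_natCast s.card,
    ← ENNReal.ofReal_mul' hpos.le, ← ENNReal.ofReal_natCast]
  exact ENNReal.ofReal_le_ofReal (hc.trans (by exact_mod_cast hle))

theorem Finset.lt_infDist {X : Type*} [MetricSpace X] {E : Finset X} (hE : E.Nonempty) {p : X}
    {r : ℝ} (h : ∀ e ∈ E, r < dist p e) : r < infDist p (E : Set X) := by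
  obtain ⟨e, he, heq⟩ := E.finite_toSet.isCompact.exists_infDist_eq_dist
    (Finset.coe_nonempty.2 hE) p
  exact heq ▸ h e (Finset.mem_coe.1 he)

theorem phi_le {X : Type*} [MetricSpace X] [Fintype X] {ε : ℝ} {z : ℕ} {A X' : Finset X} {r : ℝ}
    (hr : 0 ≤ r) (hcard : (Fintype.card X : ℝ) - (1 + ε) * z ≤ X'.card)
    (h : ∀ p ∈ X', infDist p (A : Set X) ≤ r) : phi ε z A ≤ r := by
  have hbdd : BddBelow {r : ℝ | ∃ X' : Finset X,
      (Fintype.card X : ℝ) - (1 + ε) * z ≤ X'.card ∧ r = costSet X' A} := by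
    refine ⟨0, ?_⟩
    rintro _ ⟨Y, -, rfl⟩
    refine Real.sSup_nonneg ?_
    rintro _ ⟨p, -, rfl⟩
    exact infDist_nonneg
  refine (csInf_le hbdd ⟨X', hcard, rfl⟩).trans (Real.sSup_le ?_ hr)
  rintro _ ⟨p, hp, rfl⟩
  exact h p hp

/-- The indices of the clusters that meet `E`. -/
noncomputable def hitClusters {X : Type*} {k : ℕ} (C : Fin k → Finset X) (E : Finset X) :
    Finset (Fin k) :=
  Finset.univ.filter fun l => ∃ p ∈ E, p ∈ C l

theorem mem_hitClusters {X : Type*} {k : ℕ} {C : Fin k → Finset X} {E : Finset X} {l : Fin k} :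
    l ∈ hitClusters C E ↔ ∃ p ∈ E, p ∈ C l := by
  simp [hitClusters]

/-- The sets of points from the clusters that meet exactly `m` clusters. -/
def hitsExactly {X : Type*} {k : ℕ} (C : Fin k → Finset X) (m : ℕ) : Set (Finset X) :=
  {E | (∀ p ∈ E, ∃ l, p ∈ C l) ∧ (hitClusters C E).card = m}

theorem hitClusters_insert {X : Type*} [DecidableEq X] {k : ℕ} {C : Fin k → Finset X}
    (hdisj : ∀ i j : Fin k, i ≠ j → Disjoint (C i) (C j)) {E : Finset X} {v : X} {l : Fin k}
    (hv : v ∈ C l) : hitClusters C (insert v E) = insert l (hitClusters C E) := by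
  have huniq : ∀ i, v ∈ C i → i = l := fun i hi => by
    by_contra hne
    exact Finset.disjoint_left.1 (hdisj i l hne) hi hv
  ext i
  simp only [mem_hitClusters, Finset.mem_insert, exists_eq_or_imp]
  exact or_congr_left ⟨huniq i, fun h => h ▸ hv⟩

theorem singleton_mem_hitsExactly {X : Type*} {k : ℕ} {C : Fin k → Finset X}
    (hdisj : ∀ i j : Fin k, i ≠ j → Disjoint (C i) (C j)) {v : X} {l : Fin k} (hv : v ∈ C l) :
    {v} ∈ hitsExactly C 1 := by
  refine ⟨fun p hp => ⟨l, Finset.mem_singleton.1 hp ▸ hv⟩, ?_⟩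
  have hempty : hitClusters C (∅ : Finset X) = ∅ := by simp [hitClusters]
  rw [← insert_empty_eq, hitClusters_insert hdisj hv, hempty]
  simp

theorem insert_mem_hitsExactly {X : Type*} [DecidableEq X] {k m : ℕ} {C : Fin k → Finset X}
    (hdisj : ∀ i j : Fin k, i ≠ j → Disjoint (C i) (C j)) {E : Finset X}
    (hE : E ∈ hitsExactly C m) {v : X} {l : Fin k} (hv : v ∈ C l) (hl : l ∉ hitClusters C E) :
    insert v E ∈ hitsExactly C (m + 1) := by
  refine ⟨fun p hp => ?_, ?_⟩
  · rcases Finset.mem_insert.1 hp with rfl | hp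
    · exact ⟨l, hv⟩
    · exact hE.1 p hp
  · rw [hitClusters_insert hdisj hv, Finset.card_insert_of_notMem hl, hE.2]

theorem infDist_le_of_mem_hitClusters {X : Type*} [MetricSpace X] {k : ℕ} {C : Fin k → Finset X}
    {o : Fin k → X} {r : ℝ} (hcover : ∀ l : Fin k, ∀ p ∈ C l, dist p (o l) ≤ r) {E : Finset X}
    {l : Fin k} (hl : l ∈ hitClusters C E) {p : X} (hp : p ∈ C l) :
    infDist p (E : Set X) ≤ 2 * r := by
  obtain ⟨e, he, hel⟩ := mem_hitClusters.1 hl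
  refine (infDist_le_dist_of_mem (Finset.mem_coe.2 he)).trans ?_
  linarith [dist_triangle_right p e (o l), hcover l p hp, hcover l e hel]

theorem lt_infDist_of_notMem_hitClusters {X : Type*} [MetricSpace X] {k : ℕ}
    {C : Fin k → Finset X} {o : Fin k → X} {r : ℝ}
    (hcover : ∀ l : Fin k, ∀ p ∈ C l, dist p (o l) ≤ r)
    (hsep : ∀ l l' : Fin k, l ≠ l' → 4 * r < dist (o l) (o l')) {E : Finset X}
    (hE : E.Nonempty) (hEC : ∀ p ∈ E, ∃ l, p ∈ C l) {l : Fin k} (hl : l ∉ hitClusters C E)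
    {p : X} (hp : p ∈ C l) : 2 * r < infDist p (E : Set X) := by
  refine Finset.lt_infDist hE fun e he => ?_
  obtain ⟨i, hi⟩ := hEC e he
  have hne : l ≠ i := fun h => hl (h ▸ mem_hitClusters.2 ⟨e, he, hi⟩)
  have := hsep l i hne
  have := dist_triangle4 (o l) p e (o i)
  linarith [hcover l p hp, hcover i e hi, dist_comm p (o l)]

/-- If some cluster is not met by `E`, a large set `Q` of points farthest from `E` has many points
in clusters not met by `E`. -/
theorem exists_subset_unhit {X : Type*} [MetricSpace X] [Fintype X] {k z : ℕ}
    {C : Fin k → Finset X} {o : Fin k → X} {r ε : ℝ}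
    (hcover : ∀ l : Fin k, ∀ p ∈ C l, dist p (o l) ≤ r)
    (hsep : ∀ l l' : Fin k, l ≠ l' → 4 * r < dist (o l) (o l'))
    (houtliers : (Finset.univ.filter fun p => ∀ l, p ∉ C l).card ≤ z)
    (hclsize : ∀ l : Fin k, ε * z ≤ ((C l).card : ℝ)) {E Q : Finset X}
    (hE : E.Nonempty) (hEC : ∀ p ∈ E, ∃ l, p ∈ C l) (hunhit : ∃ l, l ∉ hitClusters C E)
    (hQcard : (Q.card : ℝ) = (1 + ε) * z)
    (hQfar : ∀ p ∉ Q, ∀ q ∈ Q, infDist p (E : Set X) ≤ infDist q (E : Set X)) :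
    ∃ U ⊆ Q, (∀ v ∈ U, ∃ l, v ∈ C l ∧ l ∉ hitClusters C E) ∧ ε * z ≤ (U.card : ℝ) := by
  obtain ⟨l, hl⟩ := hunhit
  by_cases hsub : C l ⊆ Q
  · exact ⟨C l, hsub, fun v hv => ⟨l, hv, hl⟩, hclsize l⟩
  obtain ⟨p, hp, hpQ⟩ := Finset.not_subset.1 hsub
  refine ⟨Q.filter fun v => ∃ i, v ∈ C i, Finset.filter_subset _ _, fun v hv => ?_, ?_⟩
  · obtain ⟨hvQ, i, hi⟩ := Finset.mem_filter.1 hv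
    refine ⟨i, hi, fun hhit => ?_⟩
    have := infDist_le_of_mem_hitClusters hcover hhit hi
    have := lt_infDist_of_notMem_hitClusters hcover hsep hE hEC hl hp
    linarith [hQfar p hpQ v hvQ]
  · have hle : (Q.filter fun v => ¬ ∃ i, v ∈ C i).card ≤ z :=
      (Finset.card_le_card fun v hv => by simpa using (Finset.mem_filter.1 hv).2).trans houtliers
    have hsum := Finset.card_filter_add_card_filter_not (s := Q) fun v => ∃ i, v ∈ C i
    have : (Q.card : ℝ) ≤ (Q.filter fun v => ∃ i, v ∈ C i).card + z := by
      exact_mod_cast hsum ▸ Nat.add_le_add_left hle _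
    linarith

theorem card_le_of_mem_support_algorithm2 {X : Type*} [MetricSpace X] [Fintype X] [DecidableEq X]
    [Nonempty X] (F : Finset X → Finset X) (hF : ∀ E, (F E).Nonempty) (j : ℕ) :
    ∀ E ∈ (algorithm2 F hF j).support, E.card ≤ j + 1 := by
  induction j with
  | zero =>
    intro E hE
    simp only [algorithm2, PMF.support_map, Set.mem_image] at hE
    obtain ⟨v, -, rfl⟩ := hE
    simp
  | succ j ih =>
    intro E hE
    simp only [algorithm2, PMF.mem_support_bind_iff, PMF.support_map, Set.mem_image] at hE
    obtain ⟨E', hE', v, -, rfl⟩ := hE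
    exact (Finset.card_insert_le v E').trans (Nat.succ_le_succ (ih E' hE'))

/-- With probability at least `a * b ^ j`, the first `j + 1` picks lie in distinct clusters,
if the first pick is in a cluster with probability at least `a` and each later one is in a new
cluster with probability at least `b`. -/
theorem le_toOuterMeasure_algorithm2_hitsExactly {X : Type*} [MetricSpace X] [Fintype X]
    [DecidableEq X] [Nonempty X] {k : ℕ} {C : Fin k → Finset X}
    (hdisj : ∀ i j : Fin k, i ≠ j → Disjoint (C i) (C j))
    (F : Finset X → Finset X) (hF : ∀ E, (F E).Nonempty) {a b : ℝ} (hb : 0 ≤ b)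
    (hfirst : a * Fintype.card X ≤ (Finset.univ.biUnion C).card)
    (hnext : ∀ m < k, 0 < m → ∀ E ∈ hitsExactly C m, ∃ U ⊆ F E,
      (∀ v ∈ U, ∃ l, v ∈ C l ∧ l ∉ hitClusters C E) ∧ b * (F E).card ≤ U.card)
    (j : ℕ) (hj : j < k) :
    ENNReal.ofReal (a * b ^ j) ≤ (algorithm2 F hF j).toOuterMeasure (hitsExactly C (j + 1)) := by
  induction j with
  | zero =>
    rw [algorithm2, PMF.toOuterMeasure_map_apply, pow_zero, mul_one]
    refine PMF.ofReal_le_toOuterMeasure_uniformOfFinset _ _ _ (Finset.univ.biUnion C)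
      (Finset.subset_univ _) (fun v hv => ?_) _ hfirst
    obtain ⟨l, -, hl⟩ := Finset.mem_biUnion.1 hv
    exact singleton_mem_hitsExactly hdisj hl
  | succ j ih =>
    rw [algorithm2, pow_succ, ← mul_assoc, ENNReal.ofReal_mul' hb]
    refine (mul_le_mul_left (ih (by omega)) _).trans
      (PMF.mul_toOuterMeasure_le_toOuterMeasure_bind _ _ _ _ _ fun E hE => ?_)
    obtain ⟨U, hUF, hU, hcard⟩ := hnext (j + 1) hj j.succ_pos E hE
    rw [PMF.toOuterMeasure_map_apply]
    refine PMF.ofReal_le_toOuterMeasure_uniformOfFinset _ _ _ U hUF (fun v hv => ?_) _ hcard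
    obtain ⟨l, hvl, hl⟩ := hU v hv
    exact insert_mem_hitsExactly hdisj hE hvl hl

/-- Theorem 4: if every optimal cluster has at least `ε·z` points and the
optimal centers are pairwise at distance `> 4·r_opt`, then with probability at least
`(1-γ)·(ε/(1+ε))^{k-1}` Algorithm 2 returns a set `E` with `φ_0(X,E) ≤ 2·r_opt`, i.e. a
2-approximation excluding exactly `z` outliers. -/
theorem algorithm2_two_approx_exact_outliers
    {X : Type*} [MetricSpace X] [Fintype X] [DecidableEq X] [Nonempty X]
    (n k z : ℕ) (hn : Fintype.card X = n) (hz : 0 < z) (hzn : z < n) (hk : 1 ≤ k)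
    (Xopt : Finset X) (C : Fin k → Finset X) (o : Fin k → X)
    (ropt : ℝ) (hropt0 : 0 ≤ ropt)
    (hXoptcard : Xopt.card = n - z)
    (hunion : Finset.univ.biUnion C = Xopt)
    (hdisj : ∀ i j : Fin k, i ≠ j → Disjoint (C i) (C j))
    (hcover : ∀ l : Fin k, ∀ p ∈ C l, dist p (o l) ≤ ropt)
    (hoptmin : ∀ A : Finset X, A.card = k → ropt ≤ phi 0 z A)
    (hsep : ∀ l l' : Fin k, l ≠ l' → 4 * ropt < dist (o l) (o l'))
    (ε : ℝ) (hε : 0 < ε)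
    (hclsize : ∀ l : Fin k, ε * z ≤ ((C l).card : ℝ))
    (F : Finset X → Finset X) (hF : ∀ E, (F E).Nonempty)
    (hFcard : ∀ E, ((F E).card : ℝ) = (1 + ε) * z)
    (hFfar : ∀ E : Finset X, ∀ p ∉ F E, ∀ q ∈ F E,
      infDist p (E : Set X) ≤ infDist q (E : Set X))
    :
    ENNReal.ofReal ((1 - (z : ℝ) / n) * (ε / (1 + ε)) ^ (k - 1)) ≤
      (algorithm2 F hF (k - 1)).toOuterMeasure {E : Finset X | phi 0 z E ≤ 2 * ropt} ∧
    ∀ E ∈ (algorithm2 F hF (k - 1)).support, E.card ≤ k := by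
  subst hunion
  have hnpos : (0 : ℝ) < n := by exact_mod_cast hz.trans hzn
  have hcardR : ((Finset.univ.biUnion C).card : ℝ) = n - z := by
    rw [hXoptcard, Nat.cast_sub hzn.le]
  have houtliers : (Finset.univ.filter fun p => ∀ l, p ∉ C l).card ≤ z := by
    have heq : (Finset.univ.filter fun p => ∀ l, p ∉ C l) = (Finset.univ.biUnion C)ᶜ := by
      ext p
      simp
    rw [heq, Finset.card_compl, hn, hXoptcard]
    omega
  refine ⟨?_, fun E hE => ?_⟩
  · refine (le_toOuterMeasure_algorithm2_hitsExactly hdisj F hF (by positivity) ?_ ?_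
      (k - 1) (by omega)).trans (MeasureTheory.OuterMeasure.mono _ fun E hE => ?_)
    · rw [hcardR, hn]
      exact le_of_eq (by field_simp)
    · intro m hm hm0 E hE
      have hhit : (hitClusters C E).Nonempty := by
        rw [← Finset.card_pos, hE.2]
        exact hm0
      obtain ⟨l, hl⟩ := hhit
      obtain ⟨e, he, -⟩ := mem_hitClusters.1 hl
      have hunhit : ∃ l, l ∉ hitClusters C E := by
        by_contra! hall
        have := hE.2
        rw [Finset.eq_univ_iff_forall.2 hall, Finset.card_fin] at this
        omega
      obtain ⟨U, hUF, hU, hcard⟩ := exists_subset_unhit hcover hsep (by convert houtliers) hclsize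
        ⟨e, he⟩ hE.1 hunhit (hFcard E) (hFfar E)
      refine ⟨U, hUF, hU, le_trans (le_of_eq ?_) hcard⟩
      rw [hFcard]
      field_simp
    · have hall : hitClusters C E = Finset.univ := by
        rw [← Finset.card_eq_iff_eq_univ, hE.2, Fintype.card_fin]
        omega
      refine phi_le (X' := Finset.univ.biUnion C) (by positivity) ?_ fun p hp => ?_
      · rw [hcardR, hn]
        linarith
      · obtain ⟨l, -, hl⟩ := Finset.mem_biUnion.1 hp
        exact infDist_le_of_mem_hitClusters hcover (hall ▸ Finset.mem_univ l) hl
  · have := card_le_of_mem_support_algorithm2 F hF (k - 1) E hE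
    omega
end

section
/- Suppose every optimal cluster C_l has |C_l| ≥ ε·z and d(o_l, o_{l'}) > 4·r_opt for all 1 ≤ l ≠ l' ≤ k. Let E ⊆ X be a nonempty set each of whose vertices lies in some optimal cluster, let J = { l : E ∩ C_l ≠ ∅ } with J ≠ {1,...,k}, and let Q ⊆ X with |Q| = (1+ε)z be a set of the (1+ε)z vertices of X farthest from E (so d(p,E) ≤ d(q,E) for all p ∈ X∖Q, q ∈ Q). Then |Q ∩ (∪_{l∉J} C_l)| ≥ ε·z. -/
set_option autoImplicit false

open Metric
open scoped ENNReal NNReal Classical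

/-- Claim 5: under the size (`|C_l| ≥ ε·z`) and separation
(`d(o_l,o_{l'}) > 4·r_opt`) assumptions, if every vertex of `E` lies in some optimal cluster,
`J = {l : E ∩ C_l ≠ ∅} ≠ {1,…,k}`, and `Q` is a set of the `(1+ε)z` vertices farthest from
`E`, then `Q` contains at least `ε·z` points of the clusters untouched by `E`. -/
theorem far_set_meets_untouched_clusters_well_separated
    {X : Type*} [MetricSpace X] [Fintype X] [DecidableEq X]
    (n k z : ℕ) (hn : Fintype.card X = n) (hz : 0 < z) (hzn : z < n) (hk : 1 ≤ k)
    (Xopt : Finset X) (C : Fin k → Finset X) (o : Fin k → X)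
    (ropt : ℝ) (hropt0 : 0 ≤ ropt)
    (hXoptcard : Xopt.card = n - z)
    (hunion : Finset.univ.biUnion C = Xopt)
    (hdisj : ∀ i j : Fin k, i ≠ j → Disjoint (C i) (C j))
    (hcover : ∀ l : Fin k, ∀ p ∈ C l, dist p (o l) ≤ ropt)
    (hoptmin : ∀ A : Finset X, A.card = k → ropt ≤ phi 0 z A)
    (hsep : ∀ l l' : Fin k, l ≠ l' → 4 * ropt < dist (o l) (o l'))
    (ε : ℝ) (hε : 0 < ε)
    (hclsize : ∀ l : Fin k, ε * z ≤ ((C l).card : ℝ))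
    (E : Finset X) (hE : E.Nonempty) (hEin : E ⊆ Xopt)
    (hJne : Finset.univ.filter (fun l : Fin k => (E ∩ C l).Nonempty) ≠ Finset.univ)
    (Q : Finset X) (hQcard : (Q.card : ℝ) = (1 + ε) * z)
    (hQfar : ∀ p ∉ Q, ∀ q ∈ Q, infDist p (E : Set X) ≤ infDist q (E : Set X)) :
    ε * z ≤
      ((Q ∩ (Finset.univ \
          Finset.univ.filter (fun l : Fin k => (E ∩ C l).Nonempty)).biUnion C).card : ℝ) := by
  set U := (Finset.univ \
    Finset.univ.filter (fun l : Fin k => (E ∩ C l).Nonempty)).biUnion C with hU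
  have hmemU : ∀ p, p ∈ U ↔ ∃ l, ¬ (E ∩ C l).Nonempty ∧ p ∈ C l := by
    intro p
    simp [hU]
  obtain ⟨l, hl⟩ : ∃ l, ¬ (E ∩ C l).Nonempty := by
    by_contra! h
    exact hJne (Finset.filter_true_of_mem fun l _ => h l)
  by_cases hUQ : U ⊆ Q
  · have hCl : C l ⊆ Q ∩ U := fun p hp =>
      have hpU := (hmemU p).2 ⟨l, hl, hp⟩
      Finset.mem_inter.2 ⟨hUQ hpU, hpU⟩
    exact (hclsize l).trans (mod_cast Finset.card_le_card hCl)
  · obtain ⟨p, hpU, hpQ⟩ := Finset.not_subset.1 hUQ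
    obtain ⟨m, hm, hpm⟩ := (hmemU p).1 hpU
    have hfar : 2 * ropt < infDist p (E : Set X) := by
      obtain ⟨e, he, hpe⟩ := E.finite_toSet.isCompact.exists_infDist_eq_dist
        (Finset.coe_nonempty.2 hE) p
      rw [hpe]
      have heE : e ∈ E := he
      have heX := hEin heE
      rw [← hunion, Finset.mem_biUnion] at heX
      obtain ⟨j, -, hej⟩ := heX
      have hmj : m ≠ j := by
        rintro rfl
        exact hm ⟨e, Finset.mem_inter.2 ⟨heE, hej⟩⟩
      linarith [hsep m j hmj, hcover m p hpm, hcover j e hej,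
        dist_triangle4 (o m) p e (o j), dist_comm p (o m)]
    have hQsub : Q ⊆ (Q ∩ U) ∪ Xoptᶜ := by
      intro q hq
      by_cases hqX : q ∈ Xopt
      · rw [← hunion, Finset.mem_biUnion] at hqX
        obtain ⟨j, -, hqj⟩ := hqX
        have hj : ¬ (E ∩ C j).Nonempty := by
          rintro ⟨e, he⟩
          obtain ⟨heE, hej⟩ := Finset.mem_inter.1 he
          have hqe : infDist q (E : Set X) ≤ dist q e :=
            infDist_le_dist_of_mem (Finset.mem_coe.2 heE)
          linarith [hQfar p hpQ q hq, hcover j q hqj, hcover j e hej,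
            dist_triangle_right q e (o j)]
        exact Finset.mem_union_left _
          (Finset.mem_inter.2 ⟨hq, (hmemU q).2 ⟨j, hj, hqj⟩⟩)
      · exact Finset.mem_union_right _ (Finset.mem_compl.2 hqX)
    have hcompl : Xoptᶜ.card = z := by
      rw [Finset.card_compl, hn, hXoptcard]
      omega
    have hcard : Q.card ≤ (Q ∩ U).card + z := by
      rw [← hcompl]
      exact (Finset.card_le_card hQsub).trans (Finset.card_union_le _ _)
    have hcard' : (Q.card : ℝ) ≤ (Q ∩ U).card + z := mod_cast hcard
    linarith
end

section
/- Let P be a set of n points in R^D, an instance of k-center clustering with z outliers, let γ = z/n and 0 < ε ≤ 0.5, and let S ⊆ P be a subset that is an (ε,γ)-relative approximation of P with respect to the range space whose ranges are complements of unions of k Euclidean balls: for every such range π, | |π∩P|/|P| − |π∩S|/|S| | ≤ ε·max{ |π∩P|/|P|, γ }. Set z' = (1+ε)·γ·|S|. Then: (i) the k optimal balls of radius r_opt for P cover at least (1 − (1+ε)γ)·|S| points of S, so they form a feasible solution for the instance S with z' outliers; and (ii) any set of k balls of common radius r_S ≤ α·r_opt that covers at least |S| − (1+ε)z' points of S covers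 at least (1 − ((1+ε)²/(1−ε))·γ)·|P| points of P, i.e., an α-approximate solution of (k,z')_ε-center clustering on S is an α-approximate solution of (k,z)_{O(ε)}-center clustering on P. -/
set_option autoImplicit false

/-- The range determined by `k` closed Euclidean balls: the complement of their union. -/
def ballComplement {D k : ℕ} (c : Fin k → EuclideanSpace ℝ (Fin D)) (r : Fin k → ℝ) :
    Set (EuclideanSpace ℝ (Fin D)) :=
  (⋃ j, Metric.closedBall (c j) (r j))ᶜ

/-- If `s` approximates `p` with relative error `ε` above the threshold `γ`, and `p ≤ γ`, then
`s ≤ (1 + ε) * γ`. -/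
theorem le_one_add_mul_of_abs_sub_le_mul_max {p s γ ε : ℝ}
    (h : |p - s| ≤ ε * max p γ) (hp : p ≤ γ) : s ≤ (1 + ε) * γ := by
  rw [max_eq_right hp] at h
  linarith [(abs_le.mp h).1]

/-- If `s` approximates `p` with relative error `ε < 1` above the threshold `γ`, and `s ≤ t` for
some `t ≥ γ`, then `p ≤ t / (1 - ε)`. -/
theorem le_div_one_sub_of_abs_sub_le_mul_max {p s t γ ε : ℝ} (hγ : 0 ≤ γ) (hε : 0 ≤ ε)
    (hε1 : ε < 1) (h : |p - s| ≤ ε * max p γ) (hs : s ≤ t) (ht : γ ≤ t) :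
    p ≤ t / (1 - ε) := by
  rw [le_div_iff₀ (by linarith)]
  rcases le_total p γ with hp | hp
  · nlinarith
  · rw [max_eq_left hp] at h
    linarith [(abs_le.mp h).2]

/-- Theorem 5: with `S` an `(ε,γ)`-relative approximation of `P` and
`z' = (1+ε)γ|S|`: (i) the optimal `k` balls for `P` leave at most `(1+ε)γ·|S|` points of `S`
uncovered, hence are feasible for the instance `S` with `z'` outliers; (ii) any `k` balls of
radius `r_S ≤ α·r_opt` leaving at most `(1+ε)z'` points of `S` uncovered leave at most
`((1+ε)²/(1-ε))·γ·|P|` points of `P` uncovered; i.e. an `α`-approximate solution of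
`(k,z')_ε`-center clustering on `S` is an `α`-approximate solution of `(k,z)_{O(ε)}`-center
clustering on `P`. -/
theorem sample_reduction_kcenter_outliers
    (D k n z : ℕ) (hz : 0 < z) (hzn : z < n)
    (P S : Finset (EuclideanSpace ℝ (Fin D))) (hP : P.Nonempty) (hPcard : P.card = n)
    (hSP : S ⊆ P) (hS : S.Nonempty)
    (γ ε : ℝ) (hγ : γ = (z : ℝ) / n) (hε : 0 < ε) (hε2 : ε ≤ 0.5)
    (happrox : ∀ (c : Fin k → EuclideanSpace ℝ (Fin D)) (r : Fin k → ℝ),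
      |(((P : Set (EuclideanSpace ℝ (Fin D))) ∩ ballComplement c r).ncard : ℝ) / P.card -
          (((S : Set (EuclideanSpace ℝ (Fin D))) ∩ ballComplement c r).ncard : ℝ) / S.card| ≤
        ε * max ((((P : Set (EuclideanSpace ℝ (Fin D))) ∩ ballComplement c r).ncard : ℝ) / P.card) γ)
    (copt : Fin k → EuclideanSpace ℝ (Fin D)) (ropt : ℝ)
    (hcover : (((P : Set (EuclideanSpace ℝ (Fin D))) ∩
        ballComplement copt (fun _ => ropt)).ncard : ℝ) ≤ γ * n)
    (cS : Fin k → EuclideanSpace ℝ (Fin D)) (rS α : ℝ) (hα : 0 < α)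
    (hrS : rS ≤ α * ropt)
    (hScover : (((S : Set (EuclideanSpace ℝ (Fin D))) ∩
        ballComplement cS (fun _ => rS)).ncard : ℝ) ≤ (1 + ε) * ((1 + ε) * γ * S.card)) :
    (((S : Set (EuclideanSpace ℝ (Fin D))) ∩
        ballComplement copt (fun _ => ropt)).ncard : ℝ) ≤ (1 + ε) * γ * S.card ∧
    (((P : Set (EuclideanSpace ℝ (Fin D))) ∩
        ballComplement cS (fun _ => rS)).ncard : ℝ) ≤ (1 + ε) ^ 2 / (1 - ε) * γ * n := by
  have hn : (0 : ℝ) < n := by exact_mod_cast hz.trans hzn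
  have hScard : (0 : ℝ) < S.card := by exact_mod_cast hS.card_pos
  have hγ0 : 0 ≤ γ := by rw [hγ]; positivity
  rw [hPcard] at happrox
  constructor
  · rw [← div_le_iff₀ hScard]
    exact le_one_add_mul_of_abs_sub_le_mul_max (happrox copt fun _ => ropt)
      ((div_le_iff₀ hn).mpr hcover)
  · rw [← div_le_iff₀ hn, div_mul_eq_mul_div]
    refine le_div_one_sub_of_abs_sub_le_mul_max hγ0 hε.le (by norm_num at hε2; linarith)
      (happrox cS fun _ => rS) ?_
      (le_mul_of_one_le_left hγ0 (by nlinarith))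
    rw [div_le_iff₀ hScard]
    linarith
end

section
/- Let η ∈ (0,1), let x_1, x_2, ... be {0,1}-valued random variables adapted to a filtration (F_j) with E[x_j | F_{j−1}] ≤ η for every j, and let k be a positive integer. Set t = ⌈(k+√k)/(1−η)⌉. Then Pr( ∑_{s=1}^{t} (1 − x_s) ≥ k ) ≥ 1 − e^{−(1−η)/4}. (Proof via Azuma–Hoeffding applied to the super-martingale J_j = ∑_{s≤j}(x_s − η), which satisfies J_{j+1} − J_j ≤ 1.) -/
set_option autoImplicit false

open MeasureTheory

lemma integral_mul_le_of_condExp_le {Ω : Type*} {m m0 : MeasurableSpace Ω} {μ : Measure Ω}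
    [IsFiniteMeasure μ] (hm : m ≤ m0) {f g : Ω → ℝ} {c C : ℝ}
    (hf : StronglyMeasurable[m] f) (hf0 : ∀ ω, 0 ≤ f ω) (hfC : ∀ ω, f ω ≤ C)
    (hg : Integrable g μ) (hgc : ∀ᵐ ω ∂μ, (μ[g | m]) ω ≤ c) :
    ∫ ω, f ω * g ω ∂μ ≤ c * ∫ ω, f ω ∂μ := by
  have hbound : ∀ᵐ ω ∂μ, ‖f ω‖ ≤ C :=
    ae_of_all _ fun ω => by rw [Real.norm_of_nonneg (hf0 ω)]; exact hfC ω
  have hfm : AEStronglyMeasurable f μ := (hf.mono hm).aestronglyMeasurable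
  have hpull := condExp_stronglyMeasurable_mul_of_bound hm hf hg C hbound
  calc ∫ ω, f ω * g ω ∂μ = ∫ ω, (μ[f * g | m]) ω ∂μ := (integral_condExp hm).symm
    _ = ∫ ω, f ω * (μ[g | m]) ω ∂μ := integral_congr_ae hpull
    _ ≤ ∫ ω, c * f ω ∂μ := by
        refine integral_mono_ae (integrable_condExp.bdd_mul hfm hbound)
          ((Integrable.of_bound hfm C hbound).const_mul c) ?_
        filter_upwards [hgc] with ω hω
        rw [mul_comm c]
        exact mul_le_mul_of_nonneg_left hω (hf0 ω)
    _ = c * ∫ ω, f ω ∂μ := integral_const_mul c f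

lemma exp_neg_le_quadratic {s : ℝ} (hs : 0 ≤ s) : Real.exp (-s) ≤ 1 - s + s ^ 2 / 2 := by
  rw [Real.exp_neg, inv_le_iff_one_le_mul₀ (Real.exp_pos s)]
  have hpos : 0 ≤ 1 - s + s ^ 2 / 2 := by nlinarith [sq_nonneg (s - 1)]
  nlinarith [mul_le_mul_of_nonneg_left (Real.quadratic_le_exp_of_nonneg hs) hpos,
    sq_nonneg (s ^ 2)]

lemma integral_exp_neg_mul_failures_le
    {Ω : Type*} {m0 : MeasurableSpace Ω} {μ : Measure Ω} [IsProbabilityMeasure μ]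
    {ℱ : Filtration ℕ m0} {x : ℕ → Ω → ℝ} {η : ℝ}
    (hη1 : η ≤ 1) (hx01 : ∀ j : ℕ, ∀ ω : Ω, x j ω = 0 ∨ x j ω = 1)
    (hadapted : Adapted ℱ x)
    (hcond : ∀ j : ℕ, 1 ≤ j → ∀ᵐ ω ∂μ, (μ[x j | ℱ (j - 1)]) ω ≤ η)
    {s : ℝ} (hs : 0 ≤ s) (n : ℕ) :
    Integrable (fun ω => Real.exp (-s * ∑ i ∈ Finset.Icc 1 n, (1 - x i ω))) μ ∧
    ∫ ω, Real.exp (-s * ∑ i ∈ Finset.Icc 1 n, (1 - x i ω)) ∂μ ≤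
      Real.exp (-(1 - η) * (s - s ^ 2 / 2) * n) := by
  let Z : ℕ → Ω → ℝ := fun n ω => Real.exp (-s * ∑ i ∈ Finset.Icc 1 n, (1 - x i ω))
  have hZmeas (n : ℕ) : StronglyMeasurable[ℱ n] (Z n) := by
    refine (Real.measurable_exp.comp (Measurable.const_mul ?_ (-s))).stronglyMeasurable
    refine Finset.measurable_sum _ fun i hi => ?_
    exact ((hadapted i).mono (ℱ.mono (Finset.mem_Icc.mp hi).2) le_rfl).const_sub 1
  have hZ0 (n : ℕ) (ω : Ω) : 0 ≤ Z n ω := (Real.exp_pos _).le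
  have hZ1 (n : ℕ) (ω : Ω) : Z n ω ≤ 1 := by
    refine Real.exp_le_one_iff.mpr ?_
    have : 0 ≤ ∑ i ∈ Finset.Icc 1 n, (1 - x i ω) :=
      Finset.sum_nonneg fun i _ => by rcases hx01 i ω with h | h <;> simp [h]
    nlinarith
  have hZbound (n : ℕ) : ∀ᵐ ω ∂μ, ‖Z n ω‖ ≤ 1 :=
    ae_of_all _ fun ω => by rw [Real.norm_of_nonneg (hZ0 n ω)]; exact hZ1 n ω
  have hZae (n : ℕ) : AEStronglyMeasurable (Z n) μ :=
    ((hZmeas n).mono (ℱ.le n)).aestronglyMeasurable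
  have hZint (n : ℕ) : Integrable (Z n) μ := Integrable.of_bound (hZae n) 1 (hZbound n)
  have hxint (j : ℕ) : Integrable (x j) μ := by
    refine Integrable.of_bound
      ((hadapted j).mono (ℱ.le j) le_rfl).aestronglyMeasurable 1 (ae_of_all _ fun ω => ?_)
    rcases hx01 j ω with h | h <;> simp [h]
  refine ⟨hZint n, ?_⟩
  change ∫ ω, Z n ω ∂μ ≤ _
  induction n with
  | zero => simp [Z]
  | succ n ih =>
    set a := Real.exp (-s) with ha
    have ha1 : a ≤ 1 := Real.exp_le_one_iff.mpr (by linarith)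
    have hstep (ω : Ω) : Z (n + 1) ω = a * Z n ω + (1 - a) * (Z n ω * x (n + 1) ω) := by
      simp only [Z]
      rw [Finset.sum_Icc_succ_top (by omega), mul_add, Real.exp_add]
      rcases hx01 (n + 1) ω with h | h <;> simp [h, ha] <;> ring
    have hle := integral_mul_le_of_condExp_le (ℱ.le n) (hZmeas n) (hZ0 n) (hZ1 n)
      (hxint (n + 1)) (hcond (n + 1) (by omega))
    have hprod : Integrable (fun ω => Z n ω * x (n + 1) ω) μ :=
      (hxint (n + 1)).bdd_mul (hZae n) (hZbound n)
    have hfactor : a + (1 - a) * η ≤ Real.exp (-(1 - η) * (s - s ^ 2 / 2)) := by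
      have h1 := Real.add_one_le_exp (-(1 - η) * (s - s ^ 2 / 2))
      nlinarith [mul_le_mul_of_nonneg_left (exp_neg_le_quadratic hs) (sub_nonneg.mpr hη1)]
    calc ∫ ω, Z (n + 1) ω ∂μ
        = a * ∫ ω, Z n ω ∂μ + (1 - a) * ∫ ω, Z n ω * x (n + 1) ω ∂μ := by
          simp_rw [hstep]
          rw [integral_add ((hZint n).const_mul _) (hprod.const_mul _), integral_const_mul,
            integral_const_mul]
      _ ≤ (a + (1 - a) * η) * ∫ ω, Z n ω ∂μ := by
          nlinarith [mul_le_mul_of_nonneg_left hle (sub_nonneg.mpr ha1)]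
      _ ≤ Real.exp (-(1 - η) * (s - s ^ 2 / 2)) *
            Real.exp (-(1 - η) * (s - s ^ 2 / 2) * n) :=
          mul_le_mul hfactor ih (integral_nonneg (hZ0 n)) (Real.exp_pos _).le
      _ = Real.exp (-(1 - η) * (s - s ^ 2 / 2) * (n + 1 : ℕ)) := by
          rw [← Real.exp_add]; push_cast; ring_nf

lemma chernoff_exponent_le {k m : ℝ} (hk : 1 ≤ k) (hm : k + Real.sqrt k ≤ m) :
    (1 + Real.sqrt k)⁻¹ * k -
      m * ((1 + Real.sqrt k)⁻¹ - (1 + Real.sqrt k)⁻¹ ^ 2 / 2) ≤ -(1 / 4) := by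
  obtain ⟨r, hr⟩ : ∃ r, r = Real.sqrt k := ⟨_, rfl⟩
  have hr1 : 1 ≤ r := hr ▸ Real.one_le_sqrt.mpr hk
  have hrk : k = r ^ 2 := by rw [hr, Real.sq_sqrt (by linarith)]
  rw [← hr] at hm ⊢
  subst hrk
  have hs0 : 0 < (1 + r)⁻¹ := by positivity
  have hs1 : (1 + r)⁻¹ ≤ 1 / 2 := by
    rw [inv_le_comm₀ (by linarith) (by norm_num)]; norm_num; linarith
  have hrs : (1 + r)⁻¹ * r = 1 - (1 + r)⁻¹ := by field_simp; ring
  generalize (1 + r)⁻¹ = s at *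
  have hgap : 0 ≤ s - s ^ 2 / 2 := by nlinarith
  have hval : s * r ^ 2 - (r ^ 2 + r) * (s - s ^ 2 / 2) = -(1 - s) / 2 := by
    linear_combination (s * r / 2 - 1 / 2) * hrs
  nlinarith [mul_le_mul_of_nonneg_right hm hgap]

/-- the Azuma–Hoeffding argument in the proof of Theorem 1: if `x_1, x_2, …`
are `{0,1}`-valued random variables adapted to a filtration with
`E[x_j | F_{j-1}] ≤ η` for every `j ≥ 1`, then with `t = ⌈(k+√k)/(1-η)⌉`,
`Pr(∑_{s=1}^t (1-x_s) ≥ k) ≥ 1 - e^{-(1-η)/4}`. -/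
theorem supermartingale_success_count
    {Ω : Type*} {m0 : MeasurableSpace Ω} (μ : Measure Ω) [IsProbabilityMeasure μ]
    (ℱ : Filtration ℕ m0) (x : ℕ → Ω → ℝ)
    (η : ℝ) (hη : η ∈ Set.Ioo (0 : ℝ) 1)
    (hx01 : ∀ j : ℕ, ∀ ω : Ω, x j ω = 0 ∨ x j ω = 1)
    (hadapted : Adapted ℱ x)
    (hcond : ∀ j : ℕ, 1 ≤ j → ∀ᵐ ω ∂μ, (μ[x j | ℱ (j - 1)]) ω ≤ η)
    (k : ℕ) (hk : 1 ≤ k) :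
    ENNReal.ofReal (1 - Real.exp (-(1 - η) / 4)) ≤
      μ {ω : Ω | (k : ℝ) ≤
        ∑ s ∈ Finset.Icc 1 (⌈((k : ℝ) + Real.sqrt k) / (1 - η)⌉₊), (1 - x s ω)} := by
  set n := ⌈((k : ℝ) + Real.sqrt k) / (1 - η)⌉₊
  have hη' : 0 < 1 - η := sub_pos.mpr hη.2
  have hnm : (k : ℝ) + Real.sqrt k ≤ (1 - η) * n := by
    rw [mul_comm, ← div_le_iff₀ hη']
    exact Nat.le_ceil _
  set s : ℝ := (1 + Real.sqrt k)⁻¹ with hs_def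
  have hs : 0 < s := by positivity
  obtain ⟨hint, hle⟩ :=
    integral_exp_neg_mul_failures_le hη.2.le hx01 hadapted hcond hs.le n
  have hmarkov := mul_meas_ge_le_integral_of_nonneg
    (ae_of_all μ fun ω => (Real.exp_pos (-s * ∑ i ∈ Finset.Icc 1 n, (1 - x i ω))).le)
    hint (Real.exp (-s * k))
  have hexponent := chernoff_exponent_le (Nat.one_le_cast.mpr hk) hnm
  rw [← hs_def] at hexponent
  set A := {ω : Ω | (k : ℝ) ≤ ∑ i ∈ Finset.Icc 1 n, (1 - x i ω)}
  have hmeas : MeasurableSet A :=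
    measurableSet_le measurable_const <| Finset.measurable_sum _ fun i _ =>
      ((hadapted i).mono (ℱ.le i) le_rfl).const_sub 1
  have hsubset : Aᶜ ⊆ {ω | Real.exp (-s * k) ≤
      Real.exp (-s * ∑ i ∈ Finset.Icc 1 n, (1 - x i ω))} := by
    intro ω hω
    have hlt : ∑ i ∈ Finset.Icc 1 n, (1 - x i ω) < k := not_le.mp hω
    exact Real.exp_le_exp.mpr (by nlinarith)
  have htail : μ.real Aᶜ ≤ Real.exp (-(1 - η) / 4) := by
    have hmul : Real.exp (-s * k) * μ.real Aᶜ ≤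
        Real.exp (-s * k) * Real.exp (-(1 - η) / 4) := by
      calc Real.exp (-s * k) * μ.real Aᶜ
          ≤ Real.exp (-(1 - η) * (s - s ^ 2 / 2) * n) :=
            ((mul_le_mul_of_nonneg_left (measureReal_mono hsubset)
              (Real.exp_pos _).le).trans hmarkov).trans hle
        _ ≤ Real.exp (-s * k + -(1 - η) / 4) :=
            Real.exp_le_exp.mpr (by linarith [hη.1])
        _ = _ := Real.exp_add _ _
    exact le_of_mul_le_mul_left hmul (Real.exp_pos _)
  rw [← ofReal_measureReal]
  refine ENNReal.ofReal_le_ofReal ?_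
  linarith [probReal_add_probReal_compl (μ := μ) hmeas]
end
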